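/- Let R → S be a ring map making S a finitely generated projective R-module, let M be an S-module and N an R-module. Then for every i ≥ 0 there is an isomorphism Ext^i_R(M, N) ≅ Ext^i_S(M, Hom_R(S, N)), where Hom_R(S, N) is viewed as an S-module via the action on S. -/

import Mathlib

open CategoryTheory
universe u
noncomputable section
theorem aux_epi (R S : Type u) [CommRing R] [CommRing S] [Algebra R S]
    [Module.Projective R S] : (ModuleCat.coextendScalars.{u,u,u} (algebraMap R S)).PreservesEpimorphisms := by
  constructor
  intro X Y g hg
  rw [ModuleCat.epi_iff_surjective] at hg ⊢
  intro y
  have : Module.Projective R ((ModuleCat.restrictScalars (algebraMap R S)).obj (ModuleCat.of S S)) := by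
    let e : S ≃ₗ[R] ((ModuleCat.restrictScalars (algebraMap R S)).obj (ModuleCat.of S S)) :=
      { toFun := fun x => x
        invFun := fun x => x
        map_add' := fun _ _ => rfl
        map_smul' := fun r x => Algebra.smul_def r x
        left_inv := fun _ => rfl
        right_inv := fun _ => rfl }
    exact Module.Projective.of_equiv e
  obtain ⟨h, hh⟩ := Module.projective_lifting_property g.hom (ModuleCat.CoextendScalars.equiv _ _ y) hg
  refine ⟨(ModuleCat.CoextendScalars.equiv _ _).symm h, ?_⟩
  ext s
  exact LinearMap.congr_fun hh s

def cplxIso (R S : Type u) [CommRing R] [CommRing S] [Algebra R S]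
   (K : ChainComplex (ModuleCat.{u} S) ℕ) (N : ModuleCat.{u} R) :
   ((forget₂ (ModuleCat.{u} R) Ab).mapHomologicalComplex _).obj
     (ChainComplex.linearYonedaObj (((ModuleCat.restrictScalars (algebraMap R S)).mapHomologicalComplex _).obj K) R N) ≅
   ((forget₂ (ModuleCat.{u} S) Ab).mapHomologicalComplex _).obj
    (K.linearYonedaObj S ((ModuleCat.coextendScalars (algebraMap R S)).obj N)) :=
  HomologicalComplex.Hom.isoOfComponents (fun i =>
    AddEquiv.toAddCommGrpIso ((ModuleCat.restrictCoextendScalarsAdj (algebraMap R S)).homAddEquiv (K.X i) N)) (by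
      intro i j _
      ext (x : _ ⟶ _)
      exact ((ModuleCat.restrictCoextendScalarsAdj (algebraMap R S)).homEquiv_naturality_left (K.d j i) x).symm)

def hIso (R : Type u) [CommRing R] (K : CochainComplex (ModuleCat.{u} R) ℕ) (i : ℕ) :
  (((forget₂ (ModuleCat.{u} R) Ab).mapHomologicalComplex _).obj K).homology i ≅ (forget₂ (ModuleCat.{u} R) Ab).obj (K.homology i) :=
  (K.sc i).mapHomologyIso (forget₂ (ModuleCat.{u} R) Ab)
end

/-- Let `S` be an `R`-algebra which is a finitely generated projective `R`-module,
let `M` be an `S`-module and `N` an `R`-module. Then for all `i ≥ 0` there is an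
isomorphism `Ext^i_R(M, N) ≅ Ext^i_S(M, Hom_R(S, N))`, where `M` is viewed as an
`R`-module by restriction of scalars and `Hom_R(S, N)` is the coextension of scalars
of `N` (an `S`-module via the action on `S`). -/
theorem stmt_2 (R S : Type u) [CommRing R] [CommRing S] [Algebra R S]
    [Module.Finite R S] [Module.Projective R S]
    (M : ModuleCat.{u} S) (N : ModuleCat.{u} R) (i : ℕ) :
    Nonempty
      ((((Ext R (ModuleCat.{u} R) i).obj
          (Opposite.op ((ModuleCat.restrictScalars (algebraMap R S)).obj M))).obj N) ≃+
        (((Ext S (ModuleCat.{u} S) i).obj (Opposite.op M)).obj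
          ((ModuleCat.coextendScalars (algebraMap R S)).obj N))) := by
  have := aux_epi R S
  have : (ModuleCat.restrictScalars.{u} (algebraMap R S)).PreservesProjectiveObjects :=
    ⟨fun h => (ModuleCat.restrictCoextendScalarsAdj (algebraMap R S)).map_projective _ h⟩
  let P := ProjectiveResolution.of M
  let Q := (ModuleCat.restrictScalars (algebraMap R S)).mapProjectiveResolution P
  let e : (forget₂ (ModuleCat.{u} R) Ab).obj ((Q.complex.linearYonedaObj R N).homology i) ≅
      (forget₂ (ModuleCat.{u} S) Ab).obj ((P.complex.linearYonedaObj S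
        ((ModuleCat.coextendScalars (algebraMap R S)).obj N)).homology i) :=
    (hIso R _ i).symm ≪≫
      HomologicalComplex.homologyMapIso (cplxIso R S P.complex N) i ≪≫ hIso S _ i
  exact ⟨((Q.isoExt (R := R) i N).toLinearEquiv.toAddEquiv.trans
    e.addCommGroupIsoToAddEquiv).trans
    (P.isoExt (R := S) i _).toLinearEquiv.symm.toAddEquiv⟩
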